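/- Let G be a torsion group, p a prime, and R an infinite commutative domain of characteristic p such that G is a p'-group (no element of G has order divisible by p). If the group of units U(RG) of the group algebra RG satisfies a Laurent polynomial identity P (with nonzero coefficient of the identity word and every non-identity word in the support of P having nonzero sum of exponents in at least one variable), then RG satisfies the standard identity S_4 of degree four: for all y_1, y_2, y_3, y_4 in RG, the sum over all permutations σ of {1,2,3,4} of sgn(σ)·y_{σ(1)}·y_{σ(2)}·y_{σ(3)}·y_{σ(4)} equals 0. -/

import Mathlib

/-- The sum of exponents of the word `w` in the `i`-th variable (the `i`-th coordinate of
the image of `w` in the abelianization of the free group). -/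
def expSum {l : ℕ} (i : Fin l) (w : FreeGroup (Fin l)) : ℤ :=
  Multiplicative.toAdd
    (FreeGroup.lift (fun j => Multiplicative.ofAdd (if j = i then (1 : ℤ) else 0)) w)

/-- Evaluation of an element of the group algebra `R[F_l]` of the free group on the
units of an `R`-algebra `A`, induced by an assignment of the variables to units. -/
noncomputable def lpiEval {R : Type*} [CommRing R] {A : Type*} [Ring A] [Algebra R A]
    {l : ℕ} (u : Fin l → Aˣ) : MonoidAlgebra R (FreeGroup (Fin l)) →ₐ[R] A :=
  MonoidAlgebra.lift R A (FreeGroup (Fin l)) ((Units.coeHom A).comp (FreeGroup.lift u))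

/-- The group of units of `A` satisfies the Laurent polynomial identity `P`. -/
def SatisfiesLPI {R : Type*} [CommRing R] (A : Type*) [Ring A] [Algebra R A]
    {l : ℕ} (P : MonoidAlgebra R (FreeGroup (Fin l))) : Prop :=
  ∀ u : Fin l → Aˣ, lpiEval u P = 0

/-- A Laurent polynomial with nonzero coefficient of the identity word such that every
non-identity word in its support has nonzero sum of exponents in at least one variable. -/
def GoodLPI {R : Type*} [CommRing R] {l : ℕ}
    (P : MonoidAlgebra R (FreeGroup (Fin l))) : Prop :=
  P.coeff 1 ≠ 0 ∧ ∀ w ∈ P.coeff.support, w ≠ 1 → ∃ i : Fin l, expSum i w ≠ 0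


open Polynomial in
lemma trace_coeff_comm {A R : Type*} [Ring A] [CommRing R] (τ : A →+ R)
    (hτ : ∀ x y, τ (x * y) = τ (y * x)) (F H : A[X]) (j : ℕ) :
    τ ((F * H).coeff j) = τ ((H * F).coeff j) := by
  rw [coeff_mul, coeff_mul, map_sum, map_sum, ← Finset.Nat.sum_antidiagonal_swap]
  exact Finset.sum_congr rfl fun _ _ => hτ _ _

open Polynomial in
lemma trace_deriv_pow {A R : Type*} [Ring A] [CommRing R] (τ : A →+ R)
    (hτ : ∀ x y, τ (x * y) = τ (y * x)) (f : A[X]) (j n : ℕ) : ∀ k : ℕ,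
    τ ((derivative (f ^ n) * f ^ k).coeff j) =
      n * τ ((f ^ (n + k - 1) * derivative f).coeff j) := by
  induction n with
  | zero => intro k; simp
  | succ n ih =>
    intro k
    rw [pow_succ, derivative_mul, add_mul, coeff_add, map_add, mul_assoc (derivative (f ^ n)),
      ← pow_succ', ih (k + 1), trace_coeff_comm τ hτ (f ^ n * derivative f), ← mul_assoc, ← pow_add]
    have h1 : n + (k + 1) - 1 = n + k := by omega
    have h2 : n + 1 + k - 1 = n + k := by omega
    rw [h1, h2, add_comm k n]
    push_cast; ring

open Polynomial in
lemma trace_add_pow {A R : Type*} [Ring A] [CommRing R] [IsDomain R] {p : ℕ} (hp : p.Prime)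
    [CharP R p] (τ : A →+ R)
    (hτ : ∀ x y, τ (x * y) = τ (y * x)) (x y : A) :
    τ ((x + y) ^ p) = τ (x ^ p) + τ (y ^ p) := by
  set f : A[X] := C x + C y * X with hf
  have hdeg1 : f.natDegree ≤ 1 := by
    rw [hf]; compute_degree
  have hdeg : (f ^ p).natDegree < p + 1 := by
    have := natDegree_pow_le_of_le p hdeg1
    omega
  have hmid : ∀ j, j + 1 < p → τ ((f ^ p).coeff (j + 1)) = 0 := by
    intro j hj
    have h := trace_deriv_pow τ hτ f j p 0
    rw [pow_zero, mul_one, CharP.cast_eq_zero, zero_mul, coeff_derivative] at h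
    have h2 : (f ^ p).coeff (j + 1) * ((j : A) + 1) = (j + 1) • (f ^ p).coeff (j + 1) := by
      rw [nsmul_eq_mul']; push_cast; rfl
    rw [h2, map_nsmul, nsmul_eq_mul] at h
    rcases mul_eq_zero.1 h with h | h
    · rw [CharP.cast_eq_zero_iff R p] at h
      exact absurd (Nat.le_of_dvd (by omega) h) (by omega)
    · exact h
  have h0 : (f ^ p).coeff 0 = x ^ p := by
    have : constantCoeff (f ^ p) = (constantCoeff f) ^ p := map_pow _ _ _
    simpa [hf] using this
  have hpp : (f ^ p).coeff p = y ^ p := by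
    have := coeff_pow_of_natDegree_le (m := p) hdeg1
    simpa [hf] using this
  have hev : (x + y) ^ p = ∑ i ∈ Finset.range (p + 1), (f ^ p).coeff i := by
    let φ : A[X] →+* A := eval₂RingHom' (RingHom.id A) 1 (fun a => Commute.one_right _)
    have h1 : φ (f ^ p) = (x + y) ^ p := by
      rw [map_pow]; simp [φ, hf, eval₂RingHom', eval₂_add]
    rw [← h1]
    change eval₂ (RingHom.id A) 1 (f ^ p) = _
    rw [eval₂_eq_sum_range' _ hdeg]
    simp
  obtain ⟨m, rfl⟩ : ∃ m, p = m + 1 := ⟨p - 1, by have := hp.pos; omega⟩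
  rw [hev, map_sum, Finset.sum_range_succ, Finset.sum_range_succ', h0, hpp,
    Finset.sum_eq_zero, zero_add]
  intro i hi
  exact hmid i (by have := Finset.mem_range.1 hi; omega)

section
variable {R : Type*} [CommRing R] [IsDomain R] {G : Type*} [Group G]

/-- the canonical trace -/
noncomputable def gtr (R : Type*) [CommRing R] (G : Type*) [Group G] : MonoidAlgebra R G →+ R where
  toFun x := x.coeff 1
  map_zero' := by simp
  map_add' := by simp

lemma gtr_apply (R : Type*) [CommRing R] (G : Type*) [Group G] (x : MonoidAlgebra R G) :
    gtr R G x = x.coeff 1 := rfl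

lemma gtr_comm (x y : MonoidAlgebra R G) : gtr R G (x * y) = gtr R G (y * x) := by
  induction x using MonoidAlgebra.induction_linear with
  | zero => simp
  | add a b ha hb => simp only [add_mul, mul_add, map_add, ha, hb]
  | single g r =>
    simp [gtr_apply, MonoidAlgebra.coeff_mul_single_apply, MonoidAlgebra.coeff_single_mul_apply, mul_comm]

lemma gtr_pow {p : ℕ} (hp : p.Prime) [CharP R p] (hG' : ∀ g : G, ¬ (p ∣ orderOf g))
    (x : MonoidAlgebra R G) : gtr R G (x ^ p) = (gtr R G x) ^ p := by
  have := Fact.mk hp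
  induction x using MonoidAlgebra.induction_linear with
  | zero => simp [hp.ne_zero]
  | add a b ha hb =>
    rw [trace_add_pow hp _ gtr_comm, ha, hb, map_add, add_pow_char]
  | single g r =>
    rw [MonoidAlgebra.single_pow]
    by_cases hg : g = 1
    · subst hg; simp [gtr_apply]
    · have : g ^ p ≠ 1 := fun h => by
        rcases (Nat.dvd_prime hp).1 (orderOf_dvd_of_pow_eq_one h) with h1 | h1
        · exact hg (orderOf_eq_one_iff.1 h1)
        · exact hG' g (by rw [h1])
      simp [gtr_apply, Finsupp.single_apply, hg, this, hp.ne_zero]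

lemma gtr_nilpotent {p : ℕ} (hp : p.Prime) [CharP R p] (hG' : ∀ g : G, ¬ (p ∣ orderOf g))
    (x : MonoidAlgebra R G) (n : ℕ) (hx : x ^ n = 0) : gtr R G x = 0 := by
  have key : ∀ k : ℕ, gtr R G (x ^ p ^ k) = (gtr R G x) ^ p ^ k := by
    intro k
    induction k with
    | zero => simp
    | succ k ih => rw [pow_succ, pow_mul, gtr_pow hp hG', ih, ← pow_mul]
  have h0 : x ^ p ^ n = 0 := pow_eq_zero_of_le (Nat.lt_pow_self hp.one_lt).le hx
  have := key n
  rw [h0, map_zero] at this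
  exact eq_zero_of_pow_eq_zero this.symm

lemma nil_right_ideal {p : ℕ} (hp : p.Prime) [CharP R p] (hG' : ∀ g : G, ¬ (p ∣ orderOf g))
    (x : MonoidAlgebra R G) (n : ℕ) (hx : ∀ y, (x * y) ^ n = 0) : x = 0 := by
  ext g
  have := gtr_nilpotent hp hG' _ n (hx (MonoidAlgebra.single g⁻¹ 1))
  simpa [gtr_apply, MonoidAlgebra.coeff_mul_single_apply] using this

open Polynomial in
lemma poly_zero_of_eval [Infinite R] (Q : (MonoidAlgebra R G)[X])
    (h : ∀ x : R, eval (algebraMap R (MonoidAlgebra R G) x) Q = 0) : Q = 0 := by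
  ext i g
  let φ : MonoidAlgebra R G →ₗ[R] R :=
    (Finsupp.lapply g).comp (MonoidAlgebra.coeffLinearEquiv R).toLinearMap
  have hφ : ∀ x, φ x = x.coeff g := fun x => rfl
  let q : R[X] := ∑ j ∈ Finset.range (Q.natDegree + 1), C (φ (Q.coeff j)) * X ^ j
  have hq : q = 0 := by
    apply Polynomial.funext
    intro r
    have := congrArg φ (h r)
    rw [eval_eq_sum_range, map_sum, map_zero] at this
    rw [eval_zero, ← this, eval_finsetSum]
    refine Finset.sum_congr rfl fun j _ => ?_
    rw [← map_pow, ← Algebra.commutes, ← Algebra.smul_def, map_smul]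
    rw [eval_mul, eval_C, eval_pow, eval_X, smul_eq_mul, mul_comm]
  by_cases hi : i < Q.natDegree + 1
  · have := congrArg (fun t => t.coeff i) hq
    simp only [q, finsetSum_coeff, coeff_C_mul_X_pow] at this
    simpa [hi, hφ] using this
  · rw [coeff_eq_zero_of_natDegree_lt (by omega)]; simp

open Polynomial in
lemma nil_of_sq_zero [Infinite R] (q : R[X]) (hq : q ≠ 0)
    (hu : ∀ u : (MonoidAlgebra R G)ˣ, aeval (u : MonoidAlgebra R G) q = 0)
    (a b : MonoidAlgebra R G) (ha : a * a = 0) (hb : b * b = 0) :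
    (a * b) ^ (q.natDegree + 1) = 0 := by
  have key : ∀ x : R, aeval ((1 + b) + x • (a * (1 + b))) q = 0 := by
    intro x
    have h1 : (1 + x • a) * (1 - x • a) = 1 ∧ (1 - x • a) * (1 + x • a) = 1 := by
      constructor <;> simp [mul_add, add_mul, mul_sub, sub_mul, ha]
    have h2 : (1 + b) * (1 - b) = 1 ∧ (1 - b) * (1 + b) = 1 := by
      constructor <;> simp [mul_add, add_mul, mul_sub, sub_mul, hb]
    let u : (MonoidAlgebra R G)ˣ := ⟨_, _, h1.1, h1.2⟩
    let v : (MonoidAlgebra R G)ˣ := ⟨_, _, h2.1, h2.2⟩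
    have := hu (u * v)
    rw [← this]
    congr 1
    simp [u, v, add_mul]
  set m := a * (1 + b) with hm
  let f : (MonoidAlgebra R G)[X] := C (1 + b) + C m * X
  have hf1 : f.natDegree ≤ 1 := by
    simp only [f]; compute_degree
  have hQ : aeval f q = 0 := by
    apply poly_zero_of_eval
    intro x
    let φ : (MonoidAlgebra R G)[X] →+* MonoidAlgebra R G :=
      eval₂RingHom' (RingHom.id _) (algebraMap R _ x) (fun a => (Algebra.commutes x a).symm)
    have h1 : φ (aeval f q) = aeval ((1 + b) + x • m) q := by
      rw [aeval_def, hom_eval₂, aeval_def]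
      congr 1
      · ext r; simp [φ, eval₂RingHom', Polynomial.algebraMap_apply]
      · simp only [φ, f, eval₂RingHom', RingHom.coe_mk, MonoidHom.coe_mk, OneHom.coe_mk]
        rw [eval₂_add, eval₂_C, eval₂_mul_X, eval₂_C]
        simp only [RingHom.id_apply]
        rw [← Algebra.commutes, ← Algebra.smul_def]
    rw [key] at h1
    exact h1
  have hm0 : m ^ q.natDegree = 0 := by
    have h := congrArg (fun t => t.coeff q.natDegree) hQ
    simp only [aeval_eq_sum_range, finsetSum_coeff, coeff_smul, coeff_zero] at h
    rw [Finset.sum_range_succ, Finset.sum_eq_zero, zero_add] at h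
    · have h2 := coeff_pow_of_natDegree_le (m := q.natDegree) hf1
      rw [mul_one] at h2
      rw [h2] at h
      have h3 : f.coeff 1 = m := by
        simp only [f]
        rw [coeff_add, coeff_C, coeff_C_mul, coeff_X_one]
        simp
      rw [h3] at h
      ext g
      have h4 := congrArg (fun t => t.coeff g) h
      simpa [hq] using h4
    · intro i hi
      have hi := Finset.mem_range.1 hi
      rw [coeff_eq_zero_of_natDegree_lt (p := f ^ i), smul_zero]
      have := natDegree_pow_le_of_le i hf1
      omega
  have hk : ∀ k : ℕ, m ^ k * a = (a * b) ^ k * a := by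
    intro k
    induction k with
    | zero => simp
    | succ k ih =>
      rw [pow_succ', pow_succ', mul_assoc, ih, hm]
      have : a * ((a * b) ^ k * a) = 0 := by
        cases k with
        | zero => simp [ha]
        | succ k => simp only [pow_succ', ← mul_assoc, ha, zero_mul]
      simp only [mul_add, add_mul, mul_one, this, zero_add, mul_assoc]
  have := hk q.natDegree
  rw [hm0, zero_mul] at this
  rw [pow_succ, ← mul_assoc, ← this, zero_mul]

open Polynomial in
lemma idem_half [Infinite R] {p : ℕ} (hp : p.Prime) [CharP R p]
    (hG' : ∀ g : G, ¬ (p ∣ orderOf g)) (q : R[X]) (hq : q ≠ 0)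
    (hu : ∀ u : (MonoidAlgebra R G)ˣ, aeval (u : MonoidAlgebra R G) q = 0)
    (e r : MonoidAlgebra R G) (he : e * e = e) : e * r * (1 - e) = 0 := by
  apply nil_right_ideal hp hG' _ (q.natDegree + 2)
  intro s
  have h0 : (1 - e) * e = 0 := by rw [sub_mul, he, one_mul, sub_self]
  have h1 : e * (1 - e) = 0 := by rw [mul_sub, he, mul_one, sub_self]
  have h := nil_of_sq_zero q hq hu (e * r * (1 - e)) ((1 - e) * s * e)
    (by rw [mul_assoc, ← mul_assoc (1 - e), ← mul_assoc (1 - e), h0]; simp)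
    (by rw [mul_assoc, ← mul_assoc e, ← mul_assoc e, h1]; simp)
  have hd : (1 - e) * (1 - e) = 1 - e := by rw [mul_sub, mul_one, h0, sub_zero]
  have h2 : e * r * (1 - e) * ((1 - e) * s * e) = (e * r * (1 - e) * s) * e := by
    calc _ = e * r * ((1 - e) * (1 - e)) * s * e := by simp only [mul_assoc]
      _ = _ := by rw [hd]
  rw [h2] at h
  set z := e * r * (1 - e) * s with hz
  have hez : e * z = z := by rw [hz]; simp only [← mul_assoc, he]
  have h3 : ∀ k : ℕ, (z * e) ^ k * z = z ^ (k + 1) := by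
    intro k
    induction k with
    | zero => simp
    | succ k ih => rw [pow_succ', mul_assoc, ih, mul_assoc, pow_succ' z k, ← mul_assoc e, hez,
        ← pow_succ', ← pow_succ']
  rw [← h3, h, zero_mul]

open Polynomial in
lemma idem_central [Infinite R] {p : ℕ} (hp : p.Prime) [CharP R p]
    (hG' : ∀ g : G, ¬ (p ∣ orderOf g)) (q : R[X]) (hq : q ≠ 0)
    (hu : ∀ u : (MonoidAlgebra R G)ˣ, aeval (u : MonoidAlgebra R G) q = 0)
    (e r : MonoidAlgebra R G) (he : e * e = e) : e * r = r * e := by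
  have h1 := idem_half hp hG' q hq hu e r he
  have h2 := idem_half hp hG' q hq hu (1 - e) r (by
    simp [mul_sub, sub_mul, he])
  rw [mul_sub, mul_one, sub_eq_zero] at h1
  rw [sub_sub_cancel, sub_mul, sub_mul, one_mul, sub_eq_zero] at h2
  rw [h1, h2]

end

lemma comm_of_idem_central (B : Type*) [Ring B] [Finite B] [IsSemisimpleRing B]
    (h : ∀ e r : B, e * e = e → e * r = r * e) (x y : B) : x * y = y * x := by
  classical
  obtain ⟨n, D, d, inst, hd, ⟨φ⟩⟩ := IsSemisimpleRing.exists_ringEquiv_pi_matrix_divisionRing B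
  have h1 : ∀ (i : Fin n) (e r : Matrix (Fin (d i)) (Fin (d i)) (D i)), e * e = e →
      e * r = r * e := by
    intro i e r he
    have h2 := h (φ.symm (Pi.single i e)) (φ.symm (Pi.single i r)) (by
      rw [← map_mul, ← Pi.single_mul, he])
    rw [← map_mul, ← map_mul, ← Pi.single_mul, ← Pi.single_mul] at h2
    exact Pi.single_injective i (φ.symm.injective h2)
  have h3 : ∀ i, Subsingleton (Fin (d i)) := by
    intro i
    refine ⟨fun j k => ?_⟩
    by_contra hjk
    have h4 := h1 i (Matrix.single j j 1) (Matrix.single j k 1) (by simp)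
    rw [Matrix.single_mul_single_same, Matrix.single_mul_single_of_ne (h := Ne.symm hjk)] at h4
    have h5 := congrFun (congrFun h4 j) k
    simp at h5
  have h6 : ∀ i, Finite (D i) := by
    intro i
    have := hd i
    refine Finite.of_injective
      (fun t : D i => φ.symm (Pi.single i (Matrix.scalar (Fin (d i)) t))) ?_
    intro s t hst
    have h7 := Pi.single_injective i (φ.symm.injective hst)
    exact Matrix.scalar_inj.1 h7
  apply φ.injective
  rw [map_mul, map_mul]
  funext i
  ext j k
  have := h3 i
  have := h6 i
  rw [Pi.mul_apply, Pi.mul_apply, Matrix.mul_apply, Matrix.mul_apply]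
  refine Finset.sum_congr rfl fun l _ => ?_
  rw [Subsingleton.elim k j, Subsingleton.elim l j]
  exact mul_comm _ _

section
variable {R : Type*} [CommRing R] {G : Type*} [Group G]

lemma normal_of_idem_central (h : ∀ e r : MonoidAlgebra R G, e * e = e → e * r = r * e)
    [Nontrivial R] (K : Subgroup G) [Finite K] (c : R) (hc : c * (Nat.card K : R) = 1) :
    K.Normal := by
  classical
  let Z : Finset G := (Set.toFinite (K : Set G)).toFinset
  have hZ : ∀ x, x ∈ Z ↔ x ∈ K := fun x => by simp [Z]
  have hcard : Z.card = Nat.card K := by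
    exact (Set.ncard_eq_toFinset_card (K : Set G) (Set.toFinite _)).symm
  let N : MonoidAlgebra R G := ∑ x ∈ Z, MonoidAlgebra.single x 1
  have hN : ∀ x, N.coeff x = if x ∈ K then 1 else 0 := by
    intro x
    simp only [N, MonoidAlgebra.coeff_sum, Finsupp.finsetSum_apply, MonoidAlgebra.coeff_single,
      Finsupp.single_apply, Finset.sum_ite_eq', hZ]
  have h1 : ∀ x ∈ K, MonoidAlgebra.single x 1 * N = N := by
    intro x hx
    ext y
    rw [MonoidAlgebra.coeff_single_mul_apply, hN, hN, one_mul]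
    simp [K.mul_mem_cancel_left (K.inv_mem hx)]
  have h2 : N * N = (Nat.card K : R) • N := by
    conv_lhs => enter [1]; simp only [N]
    rw [Finset.sum_mul, Finset.sum_congr rfl (fun x hx => h1 x ((hZ x).1 hx)), Finset.sum_const,
      hcard, Nat.cast_smul_eq_nsmul]
  have h3 : ∀ r, N * r = r * N := by
    intro r
    have h4 := h (c • N) r (by
      rw [smul_mul_smul_comm, h2, smul_smul, mul_assoc, hc, mul_one])
    have h5 := congrArg (fun t => (Nat.card K : R) • t) h4
    simp only [smul_mul_assoc, mul_smul_comm, smul_smul] at h5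
    rw [mul_comm, hc, one_smul, one_smul] at h5
    exact h5
  constructor
  intro n hn g
  have h6 := congrArg (fun t => t.coeff (g * n)) (h3 (MonoidAlgebra.single g 1))
  simp only [MonoidAlgebra.coeff_single_mul_apply, MonoidAlgebra.coeff_mul_single_apply, hN] at h6
  by_contra hcon
  simp [hcon, hn] at h6

open scoped Pointwise in
lemma comm_of_idem_central_group [IsDomain R] {p : ℕ} (hp : p.Prime) [CharP R p]
    (hG : ∀ g : G, IsOfFinOrder g)
    (hG' : ∀ g : G, ¬ (p ∣ orderOf g))
    (h : ∀ e r : MonoidAlgebra R G, e * e = e → e * r = r * e) (g k : G) : g * k = k * g := by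
  have := Fact.mk hp
  have hn : ∀ x : G, (Subgroup.zpowers x).Normal ∧ Finite (Subgroup.zpowers x) := by
    intro x
    have hfin : Finite (Subgroup.zpowers x) := by
      have := (hG x).finite_zpowers
      exact this
    refine ⟨?_, hfin⟩
    have h0 : (Nat.card (Subgroup.zpowers x) : ZMod p) ≠ 0 := by
      rw [Nat.card_zpowers, Ne, ZMod.natCast_eq_zero_iff]
      exact hG' x
    refine normal_of_idem_central h _
      (ZMod.castHom (dvd_refl p) R (Nat.card (Subgroup.zpowers x) : ZMod p)⁻¹) ?_
    rw [← map_natCast (ZMod.castHom (dvd_refl p) R), ← map_mul, inv_mul_cancel₀ h0, map_one]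
  have := (hn g).1
  have := (hn g).2
  have := (hn k).2
  let H : Subgroup G := Subgroup.zpowers g ⊔ Subgroup.zpowers k
  have hHfin : Finite H := by
    have h1 : (H : Set G) = (Subgroup.zpowers g : Set G) * (Subgroup.zpowers k : Set G) :=
      Subgroup.normal_mul _ _
    have h2 : (H : Set G).Finite := by
      rw [h1]
      exact Set.Finite.mul (Set.toFinite _) (Set.toFinite _)
    exact h2
  have hne : NeZero (Nat.card H : ZMod p) := by
    constructor
    rw [Ne, ZMod.natCast_eq_zero_iff]
    intro hdvd
    obtain ⟨x, hx⟩ := exists_prime_orderOf_dvd_card' p hdvd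
    apply hG' (x : G)
    rw [Subgroup.orderOf_coe, hx]
  have hBfin : Finite (MonoidAlgebra (ZMod p) H) :=
    Finite.of_injective (fun x => (x.coeff : H → ZMod p)) (fun x y hxy => by
      apply MonoidAlgebra.ext
      exact DFunLike.coe_injective hxy)
  let ι : MonoidAlgebra (ZMod p) H →+* MonoidAlgebra R G :=
    (MonoidAlgebra.mapDomainRingHom R H.subtype).comp
      (MonoidAlgebra.mapRingHom H (ZMod.castHom (dvd_refl p) R))
  have hι : Function.Injective ι := by
    refine Function.Injective.comp (g := MonoidAlgebra.mapDomainRingHom R H.subtype) ?_ ?_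
    · exact MonoidAlgebra.mapDomain_injective H.subtype_injective
    · exact MonoidAlgebra.map_injective _ (ZMod.castHom (dvd_refl p) R).injective
  have hcomm := comm_of_idem_central (MonoidAlgebra (ZMod p) H) (fun e r he => by
    apply hι
    rw [map_mul, map_mul]
    exact h _ _ (by rw [← map_mul, he]))
  have hg : g ∈ H := Subgroup.mem_sup_left (Subgroup.mem_zpowers g)
  have hk : k ∈ H := Subgroup.mem_sup_right (Subgroup.mem_zpowers k)
  have h8 := hcomm (MonoidAlgebra.of _ _ ⟨g, hg⟩) (MonoidAlgebra.of _ _ ⟨k, hk⟩)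
  rw [← map_mul, ← map_mul] at h8
  exact congrArg Subtype.val (MonoidAlgebra.of_injective h8)

lemma s4_of_comm {A : Type*} [Ring A] (h : ∀ x y : A, x * y = y * x) (y : Fin 4 → A) :
    ∑ σ : Equiv.Perm (Fin 4),
        (Equiv.Perm.sign σ : ℤ) • (y (σ 0) * y (σ 1) * y (σ 2) * y (σ 3)) = 0 := by
  letI : CommRing A := { (inferInstance : Ring A) with mul_comm := h }
  have h1 : ∀ σ : Equiv.Perm (Fin 4),
      y (σ 0) * y (σ 1) * y (σ 2) * y (σ 3) = y 0 * y 1 * y 2 * y 3 := by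
    intro σ
    have := Equiv.prod_comp σ y
    simpa only [Fin.prod_univ_four] using this
  have h2 : ∑ σ : Equiv.Perm (Fin 4), (Equiv.Perm.sign σ : ℤ) = 0 := by decide
  calc _ = ∑ σ : Equiv.Perm (Fin 4), (Equiv.Perm.sign σ : ℤ) • (y 0 * y 1 * y 2 * y 3) :=
        Finset.sum_congr rfl fun σ _ => congrArg _ (h1 σ)
    _ = 0 := by rw [← Finset.sum_smul, h2, zero_smul]

lemma exists_weights {l : ℕ} (S : Finset (Fin l → ℤ)) (hS : ∀ v ∈ S, v ≠ 0) :
    ∃ k : Fin l → ℤ, ∀ v ∈ S, ∑ i, k i * v i ≠ 0 := by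
  let Q : MvPolynomial (Fin l) ℤ := ∏ v ∈ S, ∑ i, MvPolynomial.X i * MvPolynomial.C (v i)
  have hev : ∀ k : Fin l → ℤ, MvPolynomial.eval k Q = ∏ v ∈ S, ∑ i, k i * v i := by
    intro k; simp [Q]
  have hQ : Q ≠ 0 := by
    refine Finset.prod_ne_zero_iff.2 fun v hv h0 => hS v hv ?_
    funext j
    have := congrArg (MvPolynomial.eval (Pi.single j 1)) h0
    simpa [Pi.single_apply] using this
  by_contra hcon
  push Not at hcon
  apply hQ
  apply MvPolynomial.funext
  intro k
  obtain ⟨v, hv, h0⟩ := hcon k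
  rw [hev, map_zero]
  exact Finset.prod_eq_zero hv h0

open Polynomial in
lemma exists_poly {l : ℕ} (P : MonoidAlgebra R (FreeGroup (Fin l)))
    (hP : GoodLPI P) {A : Type*} [Ring A] [Algebra R A] (hLPI : SatisfiesLPI A P) :
    ∃ q : R[X], q ≠ 0 ∧ ∀ u : Aˣ, aeval (u : A) q = 0 := by
  classical
  obtain ⟨hP1, hP2⟩ := hP
  obtain ⟨k, hk⟩ := exists_weights
    ((P.coeff.support.erase 1).image (fun w i => expSum i w)) (by
      intro v hv
      obtain ⟨w, hw, rfl⟩ := Finset.mem_image.1 hv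
      obtain ⟨hw1, hw2⟩ := Finset.mem_erase.1 hw
      obtain ⟨i, hi⟩ := hP2 w hw2 hw1
      exact fun h0 => hi (congrFun h0 i))
  let E : FreeGroup (Fin l) → ℤ := fun w => ∑ i, k i * expSum i w
  have hE1 : E 1 = 0 := by simp [E, expSum]
  have hE : ∀ w ∈ P.coeff.support, w ≠ 1 → E w ≠ 0 := fun w hw hw1 =>
    hk _ (Finset.mem_image_of_mem _ (Finset.mem_erase.2 ⟨hw1, hw⟩))
  have hlift : ∀ (u : Aˣ) (w : FreeGroup (Fin l)),
      FreeGroup.lift (fun i => u ^ k i) w = u ^ E w := by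
    intro u w
    let Em : FreeGroup (Fin l) →* Aˣ :=
      { toFun := fun w => u ^ E w
        map_one' := by rw [hE1, zpow_zero]
        map_mul' := fun a b => by
          rw [← zpow_add]
          congr 1
          simp [E, expSum, mul_add, Finset.sum_add_distrib] }
    have : FreeGroup.lift (fun i => u ^ k i) = Em := by
      ext i
      simp [Em, E, expSum]
    rw [this]; rfl
  let N : ℕ := ∑ w ∈ P.coeff.support, (E w).natAbs
  have hN : ∀ w ∈ P.coeff.support, 0 ≤ (N : ℤ) + E w := by
    intro w hw
    have : (E w).natAbs ≤ N :=
      Finset.single_le_sum (f := fun w => (E w).natAbs) (fun _ _ => Nat.zero_le _) hw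
    omega
  refine ⟨∑ w ∈ P.coeff.support, C (P.coeff w) * X ^ ((N : ℤ) + E w).toNat, ?_, ?_⟩
  · intro h0
    have h1 := congrArg (fun t => t.coeff N) h0
    simp only [finsetSum_coeff, coeff_C_mul_X_pow, coeff_zero] at h1
    rw [Finset.sum_eq_single 1] at h1
    · simp [hE1] at h1
      exact hP1 h1
    · intro w hw hw1
      have h2 := hE w hw hw1
      have h3 := hN w hw
      rw [if_neg (by omega)]
    · intro h; exact absurd (Finsupp.notMem_support_iff.1 h) hP1
  · intro u
    have h1 := hLPI (fun i => u ^ k i)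
    rw [lpiEval, MonoidAlgebra.lift_apply, Finsupp.sum] at h1
    have h2 : aeval (u : A) (∑ w ∈ P.coeff.support, C (P.coeff w) * X ^ ((N : ℤ) + E w).toNat)
        = (u : A) ^ N * 0 := by
      rw [← h1, map_sum, Finset.mul_sum]
      refine Finset.sum_congr rfl fun w hw => ?_
      rw [map_mul, aeval_C, map_pow, aeval_X, ← Algebra.smul_def, mul_smul_comm]
      congr 1
      rw [MonoidHom.comp_apply, hlift, Units.coeHom_apply, ← Units.val_pow_eq_pow_val,
        ← Units.val_pow_eq_pow_val, ← Units.val_mul]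
      congr 1
      rw [← zpow_natCast, ← zpow_natCast, ← zpow_add, Int.toNat_of_nonneg (hN w hw)]
    rw [h2, mul_zero]

end

/-- Let `G` be a torsion group, `p` a prime, and `R` an infinite
commutative domain of characteristic `p` such that no element of `G` has order divisible
by `p`. If the unit group of the group algebra `RG` satisfies a Laurent polynomial
identity `P` as above, then `RG` satisfies the standard identity `S₄`. -/
theorem stmt7 {R : Type*} [CommRing R] [IsDomain R] [Infinite R]
    {p : ℕ} (hp : p.Prime) [CharP R p]
    {G : Type*} [Group G] (hG : ∀ g : G, IsOfFinOrder g)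
    (hG' : ∀ g : G, ¬ (p ∣ orderOf g))
    {l : ℕ} (P : MonoidAlgebra R (FreeGroup (Fin l)))
    (hP : GoodLPI P) (hLPI : SatisfiesLPI (MonoidAlgebra R G) P) :
    ∀ y : Fin 4 → MonoidAlgebra R G,
      ∑ σ : Equiv.Perm (Fin 4),
        (Equiv.Perm.sign σ : ℤ) • (y (σ 0) * y (σ 1) * y (σ 2) * y (σ 3)) = 0 := by
  obtain ⟨q, hq, hu⟩ := exists_poly P hP hLPI
  have hcomm := comm_of_idem_central_group (R := R) hp hG hG'
    (fun e r he => idem_central hp hG' q hq hu e r he)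
  letI : CommGroup G := { (inferInstance : Group G) with mul_comm := hcomm }
  intro y
  apply s4_of_comm
  intro a b
  exact mul_comm a b
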